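/- Let u be a smooth axially symmetric solution of the stationary Navier–Stokes system (ASNS) with smooth axially symmetric pressure p on the slab ℝ²×[0,1], satisfying the Dirichlet boundary condition u = 0 at z = 0 and z = 1, u(x) → 0 uniformly as r = |x'| → ∞, and the dyadic Dirichlet bound ∫₀¹∫_{R≤r≤2R} |∇u|² r dr dz ≤ C_D for all R ≥ 1. Then there exist a constant C > 0, depending only on C_D and on the supremum norms of u and its derivatives up to order two, and r₀ ≥ 2 such that |u(x)| ≤ C (ln r / r)^{1/2} for all x with r = |x'| ≥ r₀. -/

import Mathlib

open MeasureTheory Real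

/-- `∂_r f` for a function `f = f(r,z)`. -/
noncomputable def pdr (f : ℝ → ℝ → ℝ) (r z : ℝ) : ℝ := deriv (fun s => f s z) r

/-- `∂_z f` for a function `f = f(r,z)`. -/
noncomputable def pdz (f : ℝ → ℝ → ℝ) (r z : ℝ) : ℝ := deriv (fun t => f r t) z

/-- The axially symmetric stationary Navier–Stokes system (ASNS), imposed for all
`r > 0` and all `z ∈ S`. -/
def ASNS (ur uθ uz p : ℝ → ℝ → ℝ) (S : Set ℝ) : Prop :=
  ∀ r : ℝ, 0 < r → ∀ z ∈ S,
    ((ur r z * pdr ur r z + uz r z * pdz ur r z) - (uθ r z) ^ 2 / r + pdr p r z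
        = pdr (pdr ur) r z + (1 / r) * pdr ur r z + pdz (pdz ur) r z - ur r z / r ^ 2)
    ∧ ((ur r z * pdr uθ r z + uz r z * pdz uθ r z) + ur r z * uθ r z / r
        = pdr (pdr uθ) r z + (1 / r) * pdr uθ r z + pdz (pdz uθ) r z - uθ r z / r ^ 2)
    ∧ ((ur r z * pdr uz r z + uz r z * pdz uz r z) + pdz p r z
        = pdr (pdr uz) r z + (1 / r) * pdr uz r z + pdz (pdz uz) r z)
    ∧ (pdr ur r z + ur r z / r + pdz uz r z = 0)

/-- The Dirichlet integrand `|∇u|²` of an axially symmetric field. -/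
noncomputable def dirE (ur uθ uz : ℝ → ℝ → ℝ) (r z : ℝ) : ℝ :=
  (pdr ur r z) ^ 2 + (pdz ur r z) ^ 2 + (pdr uθ r z) ^ 2 + (pdz uθ r z) ^ 2
    + (pdr uz r z) ^ 2 + (pdz uz r z) ^ 2 + ((ur r z) ^ 2 + (uθ r z) ^ 2) / r ^ 2


/-- Sum of the absolute values of `f` and of its partial derivatives up to order two. -/
noncomputable def sup2 (f : ℝ → ℝ → ℝ) (r z : ℝ) : ℝ :=
  |f r z| + |pdr f r z| + |pdz f r z|
    + |pdr (pdr f) r z| + |pdz (pdr f) r z| + |pdz (pdz f) r z|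

lemma hasDeriv_path (f : ℝ → ℝ → ℝ) (hf : ContDiff ℝ (⊤ : ℕ∞) (fun q : ℝ × ℝ => f q.1 q.2))
    (r0 z0 t s : ℝ) :
    HasDerivAt (fun s => f (r0 + s * t) (z0 - s))
      (t * pdr f (r0 + s * t) (z0 - s) - pdz f (r0 + s * t) (z0 - s)) s := by
  have hd : Differentiable ℝ (fun q : ℝ × ℝ => f q.1 q.2) := hf.differentiable (by simp)
  set L := fderiv ℝ (fun q : ℝ × ℝ => f q.1 q.2) (r0 + s * t, z0 - s) with hL
  have hF : HasFDerivAt (fun q : ℝ × ℝ => f q.1 q.2) L (r0 + s * t, z0 - s) :=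
    (hd _).hasFDerivAt
  have h1 : pdr f (r0 + s * t) (z0 - s) = L (1, 0) := by
    have := hF.comp_hasDerivAt (r0 + s * t)
      ((hasDerivAt_id (r0 + s * t)).prodMk (hasDerivAt_const (r0 + s * t) (z0 - s)))
    exact this.deriv
  have h2 : pdz f (r0 + s * t) (z0 - s) = L (0, 1) := by
    have := hF.comp_hasDerivAt (z0 - s)
      ((hasDerivAt_const (z0 - s) (r0 + s * t)).prodMk (hasDerivAt_id (z0 - s)))
    exact this.deriv
  have hp : HasDerivAt (fun s : ℝ => (r0 + s * t, z0 - s)) ((t, -1) : ℝ × ℝ) s := by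
    have ha : HasDerivAt (fun s : ℝ => r0 + s * t) t s := by
      simpa using ((hasDerivAt_id s).mul_const t).const_add r0
    have hb : HasDerivAt (fun s : ℝ => z0 - s) (-1) s := by
      simpa using (hasDerivAt_id s).const_sub z0
    exact ha.prodMk hb
  have := hF.comp_hasDerivAt s hp
  have e : L (t, -1) = t * pdr f (r0 + s * t) (z0 - s) - pdz f (r0 + s * t) (z0 - s) := by
    rw [h1, h2]
    have : ((t, -1) : ℝ × ℝ) = t • ((1, 0) : ℝ × ℝ) - ((0, 1) : ℝ × ℝ) := by
      ext <;> simp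
    rw [this, map_sub, map_smul, smul_eq_mul]
  rw [← e]
  exact this

lemma cont_pdr (f : ℝ → ℝ → ℝ) (hf : ContDiff ℝ (⊤ : ℕ∞) (fun q : ℝ × ℝ => f q.1 q.2)) :
    Continuous (fun q : ℝ × ℝ => pdr f q.1 q.2) := by
  have hd : Differentiable ℝ (fun q : ℝ × ℝ => f q.1 q.2) := hf.differentiable (by simp)
  have hc := hf.continuous_fderiv (by simp)
  have : (fun q : ℝ × ℝ => pdr f q.1 q.2)
      = fun q => fderiv ℝ (fun q : ℝ × ℝ => f q.1 q.2) q (1, 0) := by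
    funext q
    have := (hd (q.1, q.2)).hasFDerivAt.comp_hasDerivAt q.1
      ((hasDerivAt_id q.1).prodMk (hasDerivAt_const q.1 q.2))
    exact this.deriv
  rw [this]
  exact hc.clm_apply continuous_const

lemma cont_pdz (f : ℝ → ℝ → ℝ) (hf : ContDiff ℝ (⊤ : ℕ∞) (fun q : ℝ × ℝ => f q.1 q.2)) :
    Continuous (fun q : ℝ × ℝ => pdz f q.1 q.2) := by
  have hd : Differentiable ℝ (fun q : ℝ × ℝ => f q.1 q.2) := hf.differentiable (by simp)
  have hc := hf.continuous_fderiv (by simp)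
  have : (fun q : ℝ × ℝ => pdz f q.1 q.2)
      = fun q => fderiv ℝ (fun q : ℝ × ℝ => f q.1 q.2) q (0, 1) := by
    funext q
    have := (hd (q.1, q.2)).hasFDerivAt.comp_hasDerivAt q.2
      ((hasDerivAt_const q.2 q.1).prodMk (hasDerivAt_id q.2))
    exact this.deriv
  rw [this]
  exact hc.clm_apply continuous_const

/-- The cone average of a nonnegative density is bounded by its integral over the box. -/
lemma cone_bound (g : ℝ → ℝ → ℝ) (hg : Continuous (fun q : ℝ × ℝ => g q.1 q.2))
    (hg0 : ∀ r z, 0 ≤ g r z) (E r0 z0 : ℝ) (hE : 0 ≤ E) (hr : 1 ≤ r0)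
    (hz0 : 0 ≤ z0) (hz1 : z0 ≤ 1)
    (hint : ∫⁻ q in Set.Icc r0 (2 * r0) ×ˢ Set.Icc (0:ℝ) 1, ENNReal.ofReal (g q.1 q.2)
      ≤ ENNReal.ofReal E) :
    ∫ t in (0:ℝ)..1, ∫ s in (0:ℝ)..z0, s * g (r0 + s * t) (z0 - s) ≤ E := by
  have hgc : ∀ {X : Type} [TopologicalSpace X] {a b : X → ℝ}, Continuous a → Continuous b →
      Continuous (fun x => g (a x) (b x)) := fun ha hb => hg.comp (ha.prodMk hb)
  have hΦ : Continuous (fun z => ∫ ρ in r0..(2 * r0), g ρ z) := by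
    apply intervalIntegral.continuous_parametric_intervalIntegral_of_continuous'
    exact hgc continuous_snd continuous_fst
  have hΦ0 : ∀ z, 0 ≤ ∫ ρ in r0..(2 * r0), g ρ z := fun z =>
    intervalIntegral.integral_nonneg (by linarith) (fun ρ _ => hg0 ρ z)
  -- box integral
  have hbox : ∫ z in (0:ℝ)..1, ∫ ρ in r0..(2 * r0), g ρ z ≤ E := by
    have hI : IntegrableOn (fun q : ℝ × ℝ => g q.1 q.2)
        (Set.Icc r0 (2 * r0) ×ˢ Set.Icc (0:ℝ) 1) :=
      hg.continuousOn.integrableOn_compact (isCompact_Icc.prod isCompact_Icc)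
    have h1 : ∫ q in Set.Icc r0 (2 * r0) ×ˢ Set.Icc (0:ℝ) 1, g q.1 q.2 ≤ E := by
      rw [integral_eq_lintegral_of_nonneg_ae (Filter.Eventually.of_forall fun q : ℝ × ℝ => hg0 q.1 q.2)
        hI.aestronglyMeasurable]
      exact ENNReal.toReal_le_of_le_ofReal hE hint
    rw [Measure.volume_eq_prod] at h1 hI
    rw [← Measure.prod_restrict] at h1
    rw [IntegrableOn, ← Measure.prod_restrict] at hI
    rw [integral_prod_symm _ hI] at h1
    rw [intervalIntegral.integral_of_le zero_le_one, ← integral_Icc_eq_integral_Ioc]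
    refine le_trans (le_of_eq ?_) h1
    congr 1
    funext z
    rw [intervalIntegral.integral_of_le (by linarith), ← integral_Icc_eq_integral_Ioc]
  have hswap : ∫ t in (0:ℝ)..1, ∫ s in (0:ℝ)..z0, s * g (r0 + s * t) (z0 - s)
      = ∫ s in (0:ℝ)..z0, ∫ t in (0:ℝ)..1, s * g (r0 + s * t) (z0 - s) := by
    apply intervalIntegral_intervalIntegral_swap
    have hc : Continuous (fun x : ℝ × ℝ => x.2 * g (r0 + x.2 * x.1) (z0 - x.2)) :=
      continuous_snd.mul (hgc (by fun_prop) (by fun_prop))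
    exact (hc.continuousOn.integrableOn_compact
      (isCompact_uIcc.prod isCompact_uIcc)).mono_set
      (Set.prod_mono Set.uIoc_subset_uIcc Set.uIoc_subset_uIcc)
  rw [hswap]
  have hin : ∀ s ∈ Set.Icc (0:ℝ) z0, ∫ t in (0:ℝ)..1, s * g (r0 + s * t) (z0 - s)
      ≤ ∫ ρ in r0..(2 * r0), g ρ (z0 - s) := by
    intro s hs
    rw [intervalIntegral.integral_const_mul,
      intervalIntegral.mul_integral_comp_add_mul (f := fun ρ => g ρ (z0 - s))]
    simp only [mul_zero, add_zero, mul_one]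
    apply intervalIntegral.integral_mono_interval le_rfl (by linarith [hs.1])
      (by linarith [hs.2]) (Filter.Eventually.of_forall fun ρ => hg0 ρ _)
    exact (hgc continuous_id continuous_const).intervalIntegrable _ _
  calc _ ≤ ∫ s in (0:ℝ)..z0, ∫ ρ in r0..(2 * r0), g ρ (z0 - s) := by
        apply intervalIntegral.integral_mono_on hz0 _ _ hin
        · apply Continuous.intervalIntegrable
          apply intervalIntegral.continuous_parametric_intervalIntegral_of_continuous'
          exact continuous_fst.mul (hgc (by fun_prop) (by fun_prop))
        · exact (hΦ.comp (continuous_const.sub continuous_id)).intervalIntegrable _ _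
    _ = ∫ z in (0:ℝ)..z0, ∫ ρ in r0..(2 * r0), g ρ z := by
        rw [intervalIntegral.integral_comp_sub_left (fun z => ∫ ρ in r0..(2 * r0), g ρ z)]
        simp
    _ ≤ ∫ z in (0:ℝ)..1, ∫ ρ in r0..(2 * r0), g ρ z := by
        apply intervalIntegral.integral_mono_interval le_rfl hz0 hz1
          (Filter.Eventually.of_forall hΦ0)
        exact hΦ.intervalIntegrable _ _
    _ ≤ E := hbox

lemma core (f : ℝ → ℝ → ℝ) (hf : ContDiff ℝ (⊤ : ℕ∞) (fun q : ℝ × ℝ => f q.1 q.2))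
    (hb : ∀ r, f r 0 = 0) (K D r z : ℝ) (hD : 0 ≤ D) (hr : 2 ≤ r) (hz : z ∈ Set.Icc (0:ℝ) 1)
    (hK1 : ∀ r z, |pdr f r z| ≤ K) (hK2 : ∀ r z, |pdz f r z| ≤ K)
    (hint : ∫⁻ q in Set.Icc r (2 * r) ×ˢ Set.Icc (0:ℝ) 1,
      ENNReal.ofReal (pdr f q.1 q.2 ^ 2 + pdz f q.1 q.2 ^ 2) ≤ ENNReal.ofReal (D / r)) :
    |f r z| ≤ (1 + 2 * K ^ 2 + D) * Real.sqrt (Real.log r / r) := by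
  obtain ⟨hz0, hz1⟩ := hz
  have hr0 : 0 < r := by linarith
  have hc1 := cont_pdr f hf
  have hc2 := cont_pdz f hf
  set g : ℝ → ℝ → ℝ := fun a b => pdr f a b ^ 2 + pdz f a b ^ 2 with hgdef
  have hg : Continuous (fun q : ℝ × ℝ => g q.1 q.2) := (hc1.pow 2).add (hc2.pow 2)
  have hg0 : ∀ a b, 0 ≤ g a b := fun a b => by simp only [hgdef]; positivity
  have hgK : ∀ a b, g a b ≤ 2 * K ^ 2 := fun a b => by
    have h1 := sq_le_sq' (abs_le.1 (hK1 a b)).1 (abs_le.1 (hK1 a b)).2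
    have h2 := sq_le_sq' (abs_le.1 (hK2 a b)).1 (abs_le.1 (hK2 a b)).2
    simp only [hgdef]; linarith
  have hgc : ∀ {X : Type} [TopologicalSpace X] {a b : X → ℝ}, Continuous a → Continuous b →
      Continuous (fun x => g (a x) (b x)) := fun ha hb => hg.comp (ha.prodMk hb)
  have hcone := cone_bound g hg hg0 (D / r) r z (by positivity) (by linarith) hz0 hz1 hint
  have hL : 0 < Real.log r := Real.log_pos (by linarith)
  set S := Real.sqrt (Real.log r / r) with hS
  have hSpos : 0 < S := Real.sqrt_pos.2 (by positivity)
  have hSS : S ^ 2 = Real.log r / r := Real.sq_sqrt (by positivity)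
  -- the parameter lam = S / log r, so that 1 / lam = r * S
  have hlam : (S / Real.log r) * (r * S) = 1 := by
    have : (S / Real.log r) * (r * S) = S ^ 2 * r / Real.log r := by ring
    rw [this, hSS]; field_simp
  have hlampos : 0 < S / Real.log r := by positivity
  set lam := S / Real.log r with hlamdef
  have hpt : ∀ t ∈ Set.Icc (0:ℝ) 1, |f r z| ≤ (1 + 2 * K ^ 2) * S
      + r * S * ∫ s in (0:ℝ)..z, s * g (r + s * t) (z - s) := by
    intro t ht
    set X : ℝ → ℝ := fun s => t * pdr f (r + s * t) (z - s) - pdz f (r + s * t) (z - s) with hX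
    have hXc : Continuous X := by
      have hp : Continuous (fun s : ℝ => ((r + s * t, z - s) : ℝ × ℝ)) := by fun_prop
      exact (continuous_const.mul (hc1.comp hp)).sub (hc2.comp hp)
    have hftc : ∫ s in (0:ℝ)..z, X s = - f r z := by
      rw [intervalIntegral.integral_eq_sub_of_hasDerivAt
        (fun s _ => hasDeriv_path f hf r z t s) (hXc.intervalIntegrable _ _)]
      simp [hb]
    have hXg : ∀ s, X s ^ 2 ≤ 2 * g (r + s * t) (z - s) := by
      intro s
      simp only [hX, hgdef]
      set a := pdr f (r + s * t) (z - s)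
      set b := pdz f (r + s * t) (z - s)
      have : t ^ 2 * a ^ 2 ≤ 1 * a ^ 2 :=
        mul_le_mul_of_nonneg_right (by nlinarith [ht.1, ht.2]) (sq_nonneg a)
      nlinarith [sq_nonneg (t * a + b)]
    have hGc : Continuous (fun s => s * g (r + s * t) (z - s)) :=
      continuous_id.mul (hgc (by fun_prop) (by fun_prop))
    have hA : ∀ s ∈ Set.Icc (0:ℝ) z, |X s| ≤ lam / 2 * (s + 1 / r)⁻¹
        + (2 * K ^ 2 * S + r * S * (s * g (r + s * t) (z - s))) := by
      intro s hs
      have hw : 0 < s + 1 / r := by have := hs.1; positivity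
      have h1 : |X s| ≤ lam / 2 * (s + 1 / r)⁻¹ + r * S * ((s + 1 / r) * X s ^ 2 / 2) := by
        set w := s + 1 / r
        have e : lam / 2 * w⁻¹ + r * S * (w * X s ^ 2 / 2) - |X s|
            = (r * S * w / 2) * (lam * w⁻¹ - |X s|) ^ 2 := by
          have hw' : w * w⁻¹ = 1 := mul_inv_cancel₀ hw.ne'
          rw [← sq_abs (X s)]
          generalize |X s| = x at *
          generalize w⁻¹ = v at *
          linear_combination (-(1/2) * lam * v * (lam * (r * S)) + x * (lam * (r*S))) * hw' + (x - lam * v / 2) * hlam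
        have : 0 ≤ (r * S * w / 2) * (lam * w⁻¹ - |X s|) ^ 2 := by positivity
        linarith
      have h2 : (s + 1 / r) * X s ^ 2 / 2
          ≤ s * g (r + s * t) (z - s) + 1 / r * (2 * K ^ 2) := by
        have a1 := mul_le_mul_of_nonneg_left (hXg s) hw.le
        have a2 : 1 / r * g (r + s * t) (z - s) ≤ 1 / r * (2 * K ^ 2) :=
          mul_le_mul_of_nonneg_left (hgK _ _) (by positivity)
        nlinarith
      have h3 := mul_le_mul_of_nonneg_left h2 (show 0 ≤ r * S by positivity)
      have h4 : r * S * (s * g (r + s * t) (z - s) + 1 / r * (2 * K ^ 2))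
          = 2 * K ^ 2 * S + r * S * (s * g (r + s * t) (z - s)) := by
        field_simp; ring
      linarith
    have hinvI : IntervalIntegrable (fun s : ℝ => (s + 1 / r)⁻¹) volume 0 z := by
      apply ContinuousOn.intervalIntegrable
      apply ContinuousOn.inv₀ (by fun_prop)
      intro s hs
      rw [Set.uIcc_of_le hz0] at hs
      have := hs.1
      positivity
    have hI1 : IntervalIntegrable (fun s : ℝ => lam / 2 * (s + 1 / r)⁻¹) volume 0 z :=
      hinvI.const_mul _
    have hI2 : IntervalIntegrable (fun s : ℝ => r * S * (s * g (r + s * t) (z - s))) volume 0 z :=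
      (continuous_const.mul hGc).intervalIntegrable _ _
    have hI3 : IntervalIntegrable (fun _ : ℝ => 2 * K ^ 2 * S) volume 0 z :=
      continuous_const.intervalIntegrable _ _
    have hlog : ∫ s in (0:ℝ)..z, (s + 1 / r)⁻¹ ≤ 2 * Real.log r := by
      rw [intervalIntegral.integral_comp_add_right (fun x => x⁻¹), integral_inv_of_pos (by positivity) (by positivity)]
      have : (2:ℝ) * Real.log r = Real.log (r ^ 2) := by simp
      rw [this]
      apply Real.log_le_log (by positivity)
      rw [zero_add, div_le_iff₀ (by positivity)]
      have : r ^ 2 * (1 / r) = r := by field_simp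
      rw [this]
      have : 1 / r ≤ 1 := by rw [div_le_one hr0]; linarith
      linarith
    calc |f r z| = |∫ s in (0:ℝ)..z, X s| := by rw [hftc, abs_neg]
      _ ≤ ∫ s in (0:ℝ)..z, |X s| := intervalIntegral.abs_integral_le_integral_abs hz0
      _ ≤ ∫ s in (0:ℝ)..z, (lam / 2 * (s + 1 / r)⁻¹
        + (2 * K ^ 2 * S + r * S * (s * g (r + s * t) (z - s)))) :=
          intervalIntegral.integral_mono_on hz0 (hXc.abs.intervalIntegrable _ _)
            (hI1.add (hI3.add hI2)) hA
      _ = lam / 2 * (∫ s in (0:ℝ)..z, (s + 1 / r)⁻¹) + (z * (2 * K ^ 2 * S)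
          + r * S * ∫ s in (0:ℝ)..z, s * g (r + s * t) (z - s)) := by
          rw [intervalIntegral.integral_add hI1 (hI3.add hI2),
            intervalIntegral.integral_add hI3 hI2, intervalIntegral.integral_const,
            intervalIntegral.integral_const_mul, intervalIntegral.integral_const_mul]
          simp only [sub_zero, smul_eq_mul]
      _ ≤ _ := by
          have a1 := mul_le_mul_of_nonneg_left hlog (show 0 ≤ lam / 2 by positivity)
          have a2 : lam / 2 * (2 * Real.log r) = S := by rw [hlamdef]; field_simp
          have a3 : z * (2 * K ^ 2 * S) ≤ 1 * (2 * K ^ 2 * S) :=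
            mul_le_mul_of_nonneg_right hz1 (by positivity)
          linarith
  have hJc : Continuous (fun t => ∫ s in (0:ℝ)..z, s * g (r + s * t) (z - s)) := by
    apply intervalIntegral.continuous_parametric_intervalIntegral_of_continuous'
    exact continuous_snd.mul (hgc (by fun_prop) (by fun_prop))
  have hav : ∫ _ in (0:ℝ)..1, |f r z| ≤ ∫ t in (0:ℝ)..1, ((1 + 2 * K ^ 2) * S
      + r * S * ∫ s in (0:ℝ)..z, s * g (r + s * t) (z - s)) :=
    intervalIntegral.integral_mono_on zero_le_one (continuous_const.intervalIntegrable _ _)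
      ((continuous_const.add (continuous_const.mul hJc)).intervalIntegrable _ _) hpt
  have hJ2 : Continuous (fun t => r * S * ∫ s in (0:ℝ)..z, s * g (r + s * t) (z - s)) :=
    continuous_const.mul hJc
  rw [intervalIntegral.integral_add (continuous_const.intervalIntegrable _ _)
    (hJ2.intervalIntegrable _ _), intervalIntegral.integral_const,
    intervalIntegral.integral_const, intervalIntegral.integral_const_mul] at hav
  simp only [sub_zero, one_smul] at hav
  have h5 := mul_le_mul_of_nonneg_left hcone (show 0 ≤ r * S by positivity)
  have h6 : r * S * (D / r) = D * S := by field_simp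
  linarith

/-- From the dyadic Dirichlet bound to one component. -/
lemma comp_bound (C_D r : ℝ) (hr : 1 ≤ r) (E : ℝ → ℝ → ℝ) (h : ℝ → ℝ → ℝ)
    (hh : ∀ a b, 0 ≤ h a b) (hhE : ∀ a b, h a b ≤ E a b)
    (hi : ∫⁻ q in Set.Icc r (2 * r) ×ˢ Set.Icc (0:ℝ) 1,
            ENNReal.ofReal (E q.1 q.2 * q.1) ≤ ENNReal.ofReal C_D) :
    ∫⁻ q in Set.Icc r (2 * r) ×ˢ Set.Icc (0:ℝ) 1,
      ENNReal.ofReal (h q.1 q.2) ≤ ENNReal.ofReal (max C_D 0 / r) := by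
  have hr0 : 0 < r := by linarith
  have h1 : ∫⁻ q in Set.Icc r (2 * r) ×ˢ Set.Icc (0:ℝ) 1, ENNReal.ofReal (h q.1 q.2)
      ≤ ∫⁻ q in Set.Icc r (2 * r) ×ˢ Set.Icc (0:ℝ) 1,
        ENNReal.ofReal (1 / r) * ENNReal.ofReal (E q.1 q.2 * q.1) := by
    apply setLIntegral_mono' (measurableSet_Icc.prod measurableSet_Icc)
    intro q hq
    rw [← ENNReal.ofReal_mul (by positivity)]
    apply ENNReal.ofReal_le_ofReal
    have hq1 : r ≤ q.1 := hq.1.1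
    have : h q.1 q.2 * r ≤ E q.1 q.2 * q.1 :=
      mul_le_mul (hhE _ _) hq1 hr0.le ((hh _ _).trans (hhE _ _))
    rw [one_div, inv_mul_eq_div, le_div_iff₀ hr0]
    exact this
  refine h1.trans ?_
  rw [lintegral_const_mul' _ _ ENNReal.ofReal_ne_top]
  refine (mul_le_mul_right hi _).trans ?_
  rw [← ENNReal.ofReal_mul (by positivity)]
  apply ENNReal.ofReal_le_ofReal
  rw [one_div, inv_mul_eq_div]
  gcongr
  exact le_max_left _ _

/-- Decay of the velocity in the slab: `|u| ≤ C (ln r / r)^{1/2}` for large `r`, with `C` depending only on the dyadic Dirichlet bound `C_D` and the sup-norm bound `K` of `u` and its derivatives up to order two. -/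
theorem slab_velocity_decay :
    ∀ C_D K : ℝ, ∃ C : ℝ, 0 < C ∧
      ∀ ur uθ uz p : ℝ → ℝ → ℝ,
        ContDiff ℝ (⊤ : ℕ∞) (fun q : ℝ × ℝ => ur q.1 q.2) →
        ContDiff ℝ (⊤ : ℕ∞) (fun q : ℝ × ℝ => uθ q.1 q.2) →
        ContDiff ℝ (⊤ : ℕ∞) (fun q : ℝ × ℝ => uz q.1 q.2) →
        ContDiff ℝ (⊤ : ℕ∞) (fun q : ℝ × ℝ => p q.1 q.2) →
        ASNS ur uθ uz p (Set.Icc 0 1) →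
        (∀ r : ℝ, ur r 0 = 0 ∧ uθ r 0 = 0 ∧ uz r 0 = 0
          ∧ ur r 1 = 0 ∧ uθ r 1 = 0 ∧ uz r 1 = 0) →
        (∀ ε : ℝ, 0 < ε → ∃ R : ℝ, ∀ r : ℝ, R ≤ r → ∀ z ∈ Set.Icc (0:ℝ) 1,
          |ur r z| + |uθ r z| + |uz r z| < ε) →
        (∀ R : ℝ, 1 ≤ R →
          ∫⁻ q in Set.Icc R (2 * R) ×ˢ Set.Icc (0:ℝ) 1,
            ENNReal.ofReal (dirE ur uθ uz q.1 q.2 * q.1) ≤ ENNReal.ofReal C_D) →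
        (∀ r z : ℝ, sup2 ur r z + sup2 uθ r z + sup2 uz r z ≤ K) →
        ∃ r₀ : ℝ, 2 ≤ r₀ ∧ ∀ r : ℝ, r₀ ≤ r → ∀ z ∈ Set.Icc (0:ℝ) 1,
          Real.sqrt ((ur r z) ^ 2 + (uθ r z) ^ 2 + (uz r z) ^ 2) ≤ C * Real.sqrt (Real.log r / r) := by
  intro C_D K
  refine ⟨3 * (1 + 2 * K ^ 2 + max C_D 0), by positivity, ?_⟩
  intro ur uθ uz p hur huθ huz _ _ hbc _ hdir hsup
  refine ⟨2, le_rfl, ?_⟩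
  intro r hr z hz
  have hs : ∀ a b, |pdr ur a b| ≤ K ∧ |pdz ur a b| ≤ K ∧ |pdr uθ a b| ≤ K ∧ |pdz uθ a b| ≤ K
      ∧ |pdr uz a b| ≤ K ∧ |pdz uz a b| ≤ K := by
    intro a b
    have hk : ∀ f : ℝ → ℝ → ℝ, 0 ≤ sup2 f a b ∧ |pdr f a b| ≤ sup2 f a b
        ∧ |pdz f a b| ≤ sup2 f a b := by
      intro f
      unfold sup2
      have := abs_nonneg (f a b)
      have := abs_nonneg (pdr f a b)
      have := abs_nonneg (pdz f a b)
      have := abs_nonneg (pdr (pdr f) a b)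
      have := abs_nonneg (pdz (pdr f) a b)
      have := abs_nonneg (pdz (pdz f) a b)
      refine ⟨?_, ?_, ?_⟩ <;> linarith
    have h0 := hsup a b
    obtain ⟨a1, a2, a3⟩ := hk ur
    obtain ⟨b1, b2, b3⟩ := hk uθ
    obtain ⟨c1, c2, c3⟩ := hk uz
    refine ⟨?_, ?_, ?_, ?_, ?_, ?_⟩ <;> linarith
  have hq : ∀ a b, 0 ≤ ((ur a b) ^ 2 + (uθ a b) ^ 2) / a ^ 2 := fun a b => by positivity
  have hD : 0 ≤ max C_D 0 := le_max_right _ _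
  have hi := hdir r (by linarith)
  have k1 := core ur hur (fun r => (hbc r).1) K (max C_D 0) r z hD hr hz
    (fun a b => (hs a b).1) (fun a b => (hs a b).2.1)
    (comp_bound C_D r (by linarith) (dirE ur uθ uz) (fun a b => pdr ur a b ^ 2 + pdz ur a b ^ 2)
      (fun a b => by positivity)
      (fun a b => by
        unfold dirE
        linarith [hq a b, sq_nonneg (pdr uθ a b), sq_nonneg (pdz uθ a b),
          sq_nonneg (pdr uz a b), sq_nonneg (pdz uz a b)]) hi)
  have k2 := core uθ huθ (fun r => (hbc r).2.1) K (max C_D 0) r z hD hr hz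
    (fun a b => (hs a b).2.2.1) (fun a b => (hs a b).2.2.2.1)
    (comp_bound C_D r (by linarith) (dirE ur uθ uz) (fun a b => pdr uθ a b ^ 2 + pdz uθ a b ^ 2)
      (fun a b => by positivity)
      (fun a b => by
        unfold dirE
        linarith [hq a b, sq_nonneg (pdr ur a b), sq_nonneg (pdz ur a b),
          sq_nonneg (pdr uz a b), sq_nonneg (pdz uz a b)]) hi)
  have k3 := core uz huz (fun r => (hbc r).2.2.1) K (max C_D 0) r z hD hr hz
    (fun a b => (hs a b).2.2.2.2.1) (fun a b => (hs a b).2.2.2.2.2)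
    (comp_bound C_D r (by linarith) (dirE ur uθ uz) (fun a b => pdr uz a b ^ 2 + pdz uz a b ^ 2)
      (fun a b => by positivity)
      (fun a b => by
        unfold dirE
        linarith [hq a b, sq_nonneg (pdr ur a b), sq_nonneg (pdz ur a b),
          sq_nonneg (pdr uθ a b), sq_nonneg (pdz uθ a b)]) hi)
  have hsum : Real.sqrt ((ur r z) ^ 2 + (uθ r z) ^ 2 + (uz r z) ^ 2)
      ≤ |ur r z| + |uθ r z| + |uz r z| := by
    apply Real.sqrt_le_iff.2
    refine ⟨by positivity, ?_⟩
    rw [← sq_abs (ur r z), ← sq_abs (uθ r z), ← sq_abs (uz r z)]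
    have := mul_nonneg (abs_nonneg (ur r z)) (abs_nonneg (uθ r z))
    have := mul_nonneg (abs_nonneg (ur r z)) (abs_nonneg (uz r z))
    have := mul_nonneg (abs_nonneg (uθ r z)) (abs_nonneg (uz r z))
    nlinarith
  linarith
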